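/- For every fixed w > 0, the map sending the optimal value to the optimal standard deviation is monotonically decreasing as the distance varies: for all 0 < d₁ < d₂, one has simultaneously V(σ*(d₂, w), d₂, w) < V(σ*(d₁, w), d₁, w) and σ*(d₁, w) < σ*(d₂, w), where σ*(d, w) = sqrt((2dw + w²) / (2·ln(1 + w/d))). -/

import Mathlib

open Real MeasureTheory

/-- Gaussian density with mean 0 and standard deviation `σ`. -/
noncomputable def gauss (σ x : ℝ) : ℝ :=
  (1 / (σ * Real.sqrt (2 * Real.pi))) * Real.exp (-x ^ 2 / (2 * σ ^ 2))

/-- The value function: probability that a `N(0, σ²)` variable lies in `[d, d+w]`. -/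
noncomputable def V (σ d w : ℝ) : ℝ := ∫ x in d..(d + w), gauss σ x

/-- The claimed optimal standard deviation. -/
noncomputable def sigmaStar (d w : ℝ) : ℝ :=
  Real.sqrt ((2 * d * w + w ^ 2) / (2 * Real.log (1 + w / d)))

theorem log_one_add_div_pos {d w : ℝ} (hd : 0 < d) (hw : 0 < w) : 0 < Real.log (1 + w / d) :=
  Real.log_pos (by have := div_pos hw hd; linarith)

theorem sigmaStar_pos {d w : ℝ} (hd : 0 < d) (hw : 0 < w) : 0 < sigmaStar d w := by
  have := log_one_add_div_pos hd hw
  exact Real.sqrt_pos.2 (by positivity)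

theorem sigmaStar_lt_sigmaStar {d₁ d₂ w : ℝ} (hw : 0 < w) (hd₁ : 0 < d₁) (h : d₁ < d₂) :
    sigmaStar d₁ w < sigmaStar d₂ w := by
  have hd₂ := hd₁.trans h
  have hlog₁ := log_one_add_div_pos hd₁ hw
  have hlog₂ := log_one_add_div_pos hd₂ hw
  have hle : Real.log (1 + w / d₂) ≤ Real.log (1 + w / d₁) :=
    Real.log_le_log (by positivity) (by gcongr)
  apply Real.sqrt_lt_sqrt (by positivity)
  exact div_lt_div₀ (by nlinarith) (by linarith) (by positivity) (by positivity)

theorem continuous_gauss (σ : ℝ) : Continuous (gauss σ) := by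
  unfold gauss
  fun_prop

theorem gauss_lt_gauss {σ x y : ℝ} (hσ : 0 < σ) (hx : 0 ≤ x) (h : x < y) :
    gauss σ y < gauss σ x := by
  unfold gauss
  gcongr

/-- For fixed `σ` and width, the value strictly decreases with the distance. -/
theorem V_lt_V_of_lt {σ d₁ d₂ w : ℝ} (hσ : 0 < σ) (hw : 0 < w) (hd₁ : 0 < d₁) (h : d₁ < d₂) :
    V σ d₂ w < V σ d₁ w := by
  have hshift : V σ d₂ w = ∫ x in d₁..(d₁ + w), gauss σ (x + (d₂ - d₁)) := by
    rw [intervalIntegral.integral_comp_add_right, V]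
    congr 1 <;> ring
  rw [hshift, V]
  have hlt : ∀ x ∈ Set.Icc d₁ (d₁ + w), gauss σ (x + (d₂ - d₁)) < gauss σ x := fun x hx =>
    gauss_lt_gauss hσ (hd₁.le.trans hx.1) (by linarith)
  apply intervalIntegral.integral_lt_integral_of_continuousOn_of_le_of_exists_lt (by linarith)
  · exact ((continuous_gauss σ).comp (continuous_add_const _)).continuousOn
  · exact (continuous_gauss σ).continuousOn
  · exact fun x hx => (hlt x (Set.Ioc_subset_Icc_self hx)).le
  · exact ⟨d₁, Set.left_mem_Icc.2 (by linarith), hlt d₁ (Set.left_mem_Icc.2 (by linarith))⟩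

/-- The value as an integral of the unnormalised standard Gaussian. -/
theorem V_eq_integral_exp {σ : ℝ} (hσ : 0 < σ) (d w : ℝ) :
    V σ d w = (√(2 * π))⁻¹ * ∫ x in d * σ⁻¹..(d + w) * σ⁻¹, Real.exp (-x ^ 2 / 2) := by
  rw [← intervalIntegral.mul_integral_comp_mul_right, ← mul_assoc,
    ← intervalIntegral.integral_const_mul, V]
  congr 1 with x
  unfold gauss
  congr 1
  · field_simp
  · congr 1
    field_simp

theorem mul_exp_le_mul_exp {d w t : ℝ} (hd : 0 < d) (hw : 0 < w) (ht₀ : 0 ≤ t)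
    (ht : t ≤ (sigmaStar d w)⁻¹) :
    d * Real.exp (-(d * t) ^ 2 / 2) ≤ (d + w) * Real.exp (-((d + w) * t) ^ 2 / 2) := by
  have hlog := log_one_add_div_pos hd hw
  have hsq : t ^ 2 ≤ 2 * Real.log (1 + w / d) / (2 * d * w + w ^ 2) := by
    calc t ^ 2 ≤ ((sigmaStar d w)⁻¹) ^ 2 := by gcongr
      _ = _ := by rw [inv_pow, sigmaStar, Real.sq_sqrt (by positivity), inv_div]
  rw [le_div_iff₀ (by positivity)] at hsq
  have hdw : d + w = d * Real.exp (Real.log (1 + w / d)) := by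
    rw [Real.exp_log (by positivity)]
    field_simp
  calc d * Real.exp (-(d * t) ^ 2 / 2)
      ≤ d * Real.exp (Real.log (1 + w / d) + -((d + w) * t) ^ 2 / 2) := by
        gcongr
        linarith
    _ = (d + w) * Real.exp (-((d + w) * t) ^ 2 / 2) := by
        rw [Real.exp_add, ← mul_assoc, ← hdw]

/-- Beyond `sigmaStar d w`, the value is at most the value at `sigmaStar d w`. -/
theorem V_le_V_sigmaStar {σ d w : ℝ} (hd : 0 < d) (hw : 0 < w) (h : sigmaStar d w ≤ σ) :
    V σ d w ≤ V (sigmaStar d w) d w := by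
  have hs := sigmaStar_pos hd hw
  have hσ := hs.trans_le h
  rw [V_eq_integral_exp hσ, V_eq_integral_exp hs]
  have hcont : Continuous fun x : ℝ => Real.exp (-x ^ 2 / 2) := by fun_prop
  have hint (a b : ℝ) : IntervalIntegrable (fun x : ℝ => Real.exp (-x ^ 2 / 2)) volume a b :=
    hcont.intervalIntegrable a b
  have hle : (∫ x in d * σ⁻¹..d * (sigmaStar d w)⁻¹, Real.exp (-x ^ 2 / 2)) ≤
      ∫ x in (d + w) * σ⁻¹..(d + w) * (sigmaStar d w)⁻¹, Real.exp (-x ^ 2 / 2) := by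
    rw [← intervalIntegral.mul_integral_comp_mul_left,
      ← intervalIntegral.mul_integral_comp_mul_left,
      ← intervalIntegral.integral_const_mul, ← intervalIntegral.integral_const_mul]
    apply intervalIntegral.integral_mono_on (by gcongr)
    · exact Continuous.intervalIntegrable (by fun_prop) _ _
    · exact Continuous.intervalIntegrable (by fun_prop) _ _
    · exact fun t ht => mul_exp_le_mul_exp hd hw ((inv_pos.2 hσ).le.trans ht.1) ht.2
  gcongr
  have hleft := intervalIntegral.integral_add_adjacent_intervals
    (hint (d * σ⁻¹) (d * (sigmaStar d w)⁻¹))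
    (hint (d * (sigmaStar d w)⁻¹) ((d + w) * (sigmaStar d w)⁻¹))
  have hright := intervalIntegral.integral_add_adjacent_intervals
    (hint (d * σ⁻¹) ((d + w) * σ⁻¹)) (hint ((d + w) * σ⁻¹) ((d + w) * (sigmaStar d w)⁻¹))
  linarith

theorem value_to_sigma_monotone (w : ℝ) (hw : 0 < w) :
    ∀ d₁ d₂ : ℝ, 0 < d₁ → d₁ < d₂ →
      V (sigmaStar d₂ w) d₂ w < V (sigmaStar d₁ w) d₁ w ∧
      sigmaStar d₁ w < sigmaStar d₂ w := by
  intro d₁ d₂ hd₁ h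
  have hσ := sigmaStar_lt_sigmaStar hw hd₁ h
  exact ⟨(V_lt_V_of_lt (sigmaStar_pos (hd₁.trans h) hw) hw hd₁ h).trans_le
    (V_le_V_sigmaStar hd₁ hw hσ.le), hσ⟩
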